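/- Under assumptions (A1)-(A3), for every û ∈ ℤ_+^{Λ(M)}, the hitting probabilities of the induced Markov chain X_M satisfy lim_{u∈ℤ_+^{Λ(M)}, |u|→∞} (1/|u|) log P_û(X_M(t) = u for some t ≥ 0) = 0. -/

import Mathlib

open Filter Topology

attribute [local instance] Classical.propDecidable

noncomputable section

variable {V : Type*} [AddCommGroup V]

/-- `n`-step transition kernel of the random walk with step distribution `μ`,
killed upon leaving the set `A` : `kern μ A n x y = P_x(S n = y, τ_A > n)`,
where `τ_A` is the first exit time from `A`. -/
def kern (μ : V → ℝ) (A : Set V) : ℕ → V → V → ℝ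
  | 0 => fun x y => if x = y ∧ x ∈ A then 1 else 0
  | n + 1 => fun x y => ∑' z : V, (if x ∈ A then μ (z - x) else 0) * kern μ A n z y

/-- Green function of the walk killed outside `A`. -/
def green (μ : V → ℝ) (A : Set V) (x y : V) : ℝ :=
  ∑' n : ℕ, kern μ A n x y

/-- `E_x [ g(S τ) ; S τ ∈ B, τ < ∞ ]`, where `τ` is the first exit time from `A`. -/
def exitExp (μ : V → ℝ) (A B : Set V) (g : V → ℝ) (x : V) : ℝ :=
  ∑' n : ℕ, ∑' z : V, kern μ A n x z *
    ∑' y : V, (if y ∉ A ∧ y ∈ B then μ (y - z) else 0) * g y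

/-- `ℝ≥0∞`-valued version of `exitExp`. -/
def exitExpE (μ : V → ℝ) (A B : Set V) (g : V → ℝ) (x : V) : ENNReal :=
  ∑' n : ℕ, ∑' z : V, ENNReal.ofReal (kern μ A n x z) *
    ∑' y : V, ENNReal.ofReal ((if y ∉ A ∧ y ∈ B then μ (y - z) else 0) * g y)

/-- `P_x(S t = y for some t ≥ 0)` for the walk killed outside `A`
(first passage decomposition). -/
def hitProb (μ : V → ℝ) (A : Set V) (x y : V) : ℝ :=
  (if x = y ∧ x ∈ A then 1 else 0) +
    ∑' n : ℕ, ∑' z : V, kern μ (A \ {y}) n x z * (if y ∈ A then μ (y - z) else 0)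

/-- `h` is (strictly speaking, satisfies the mean value property of a) harmonic
function on `A` for the walk with step distribution `μ` killed outside `A`. -/
def HarmOn (μ : V → ℝ) (A : Set V) (h : V → ℝ) : Prop :=
  ∀ x ∈ A, h x = ∑' y : V, if y ∈ A then μ (y - x) * h y else 0

/-- Irreducibility of the walk killed outside `A`. -/
def Irred (μ : V → ℝ) (A : Set V) : Prop :=
  ∀ x ∈ A, ∀ x' ∈ A, ∃ (k : ℕ) (c : ℕ → V), c 0 = x ∧ c k = x' ∧
    (∀ j ≤ k, c j ∈ A) ∧ ∀ j < k, 0 < μ (c (j + 1) - c j)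

/-- A sequence `xs` is fundamental for the walk killed outside `A` :
the Martin kernels `G(x, xs n)/G(x₀, xs n)` converge for every `x ∈ A`. -/
def Fundamental (μ : V → ℝ) (A : Set V) (x₀ : V) (xs : ℕ → V) : Prop :=
  ∀ x ∈ A, ∃ L : ℝ,
    Tendsto (fun n => green μ A x (xs n) / green μ A x₀ (xs n)) atTop (𝓝 L)

/-- ℓ¹-norm of an integer vector. -/
def znorm {ι : Type*} [Fintype ι] (x : ι → ℤ) : ℝ := ∑ i, |(x i : ℝ)|

/-- ℓ¹-norm of a real vector. -/
def rnorm {ι : Type*} [Fintype ι] (q : ι → ℝ) : ℝ := ∑ i, |q i|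

variable {d : ℕ}

/-- `ℤ^{Λ,d}_+ = {x ∈ ℤ^d : xⁱ > 0 for all i ∈ Λ}`. -/
def posDom (Λ : Set (Fin d)) : Set (Fin d → ℤ) := {x | ∀ i ∈ Λ, 0 < x i}

/-- `ℤ^d_+ = {x ∈ ℤ^d : xⁱ > 0 for all i}`. -/
def posAll : Set (Fin d → ℤ) := {x | ∀ i, 0 < x i}

/-- `a · z` for `a ∈ ℝ^d`, `z ∈ ℤ^d`. -/
def dotZ (a : Fin d → ℝ) (z : Fin d → ℤ) : ℝ := ∑ i, a i * (z i : ℝ)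

/-- `a · q` for `a, q ∈ ℝ^d`. -/
def dotR (a q : Fin d → ℝ) : ℝ := ∑ i, a i * q i

/-- jump generating function `φ(a) = Σ_z μ(z) exp(a·z)` (valued in `ℝ≥0∞`). -/
def phiE (μ : (Fin d → ℤ) → ℝ) (a : Fin d → ℝ) : ENNReal :=
  ∑' z : Fin d → ℤ, ENNReal.ofReal (μ z * Real.exp (dotZ a z))

/-- `D = {a ∈ ℝ^d : φ(a) ≤ 1}`. -/
def Dset (μ : (Fin d → ℤ) → ℝ) : Set (Fin d → ℝ) := {a | phiE μ a ≤ 1}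

/-- mean vector `M = Σ_z μ(z) z`. -/
def Mvec (μ : (Fin d → ℤ) → ℝ) : Fin d → ℝ := fun i => ∑' z : Fin d → ℤ, μ z * (z i : ℝ)

/-- `Λ(M) = {i : Mⁱ = 0}`. -/
def LambdaM (μ : (Fin d → ℤ) → ℝ) : Set (Fin d) := {i | Mvec μ i = 0}

/-- Assumption (A1) : irreducibility on every `ℤ^{Λ,d}_+`. -/
def A1 (μ : (Fin d → ℤ) → ℝ) : Prop := ∀ Λ : Set (Fin d), Irred μ (posDom Λ)

/-- Assumption (A2) : `φ` is finite on a neighborhood of the set `D`. -/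
def A2 (μ : (Fin d → ℤ) → ℝ) : Prop :=
  ∃ U : Set (Fin d → ℝ), IsOpen U ∧ Dset μ ⊆ U ∧ ∀ a ∈ U, phiE μ a ≠ ⊤

/-- Assumption (A3) : `M ≠ 0`. -/
def A3 (μ : (Fin d → ℤ) → ℝ) : Prop := Mvec μ ≠ 0

/-- projection `x ↦ x^Λ`. -/
def projL (Λ : Set (Fin d)) (x : Fin d → ℤ) : ↥Λ → ℤ := fun i => x (i : Fin d)

/-- jump distribution `μ_Λ(v) = Σ_{x : x^Λ = v} μ(x)` of the projected walk. -/
def muL (μ : (Fin d → ℤ) → ℝ) (Λ : Set (Fin d)) (v : ↥Λ → ℤ) : ℝ :=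
  ∑' x : Fin d → ℤ, if projL Λ x = v then μ x else 0

/-- `ℤ^Λ_+`. -/
def posL (Λ : Set (Fin d)) : Set (↥Λ → ℤ) := {u | ∀ i, 0 < u i}

end

open scoped ENNReal

/-! ### Hitting probabilities with values in `ℝ≥0∞` -/

section Hitting

variable {V : Type*} [AddCommGroup V]

/-- `ℝ≥0∞`-valued version of `kern`. -/
noncomputable def kernE (p : V → ℝ≥0∞) (A : Set V) : ℕ → V → V → ℝ≥0∞
  | 0 => fun x y => if x = y ∧ x ∈ A then 1 else 0
  | n + 1 => fun x y => ∑' z : V, (if x ∈ A then p (z - x) else 0) * kernE p A n z y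

/-- `P_x(S (n + 1) = y, S 0, …, S n ∈ A \ {y})`. -/
noncomputable def firstHitE (p : V → ℝ≥0∞) (A : Set V) (y : V) (n : ℕ) (x : V) : ℝ≥0∞ :=
  ∑' z : V, kernE p (A \ {y}) n x z * (if y ∈ A then p (y - z) else 0)

/-- `ℝ≥0∞`-valued version of `hitProb`. -/
noncomputable def hitE (p : V → ℝ≥0∞) (A : Set V) (x y : V) : ℝ≥0∞ :=
  (if x = y ∧ x ∈ A then 1 else 0) + ∑' n : ℕ, firstHitE p A y n x

variable {p : V → ℝ≥0∞} {A : Set V}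

lemma tsum_sub_eq (f : V → ℝ≥0∞) (x : V) : ∑' z, f (z - x) = ∑' z, f z :=
  (Equiv.subRight x).tsum_eq f

lemma kernE_of_notMem (n : ℕ) {x : V} (y : V) (hx : x ∉ A) : kernE p A n x y = 0 := by
  cases n <;> simp [kernE, hx]

lemma kernE_eq_zero_of_target_notMem (n : ℕ) (x : V) {y : V} (hy : y ∉ A) :
    kernE p A n x y = 0 := by
  induction n generalizing x with
  | zero =>
    have : ¬ (x = y ∧ x ∈ A) := by rintro ⟨rfl, h⟩; exact hy h
    simp [kernE, this]
  | succ n ih => simp [kernE, ih]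

lemma kernE_le_one (hp : ∑' z, p z = 1) (n : ℕ) (x y : V) : kernE p A n x y ≤ 1 := by
  induction n generalizing x with
  | zero => simp only [kernE]; split_ifs <;> simp
  | succ n ih =>
    calc kernE p A (n + 1) x y ≤ ∑' z, p (z - x) := by
          refine ENNReal.tsum_le_tsum fun z => ?_
          calc _ ≤ p (z - x) * 1 := by
                gcongr
                · split_ifs <;> simp
                · exact ih z
            _ = _ := mul_one _
      _ = 1 := by rw [tsum_sub_eq, hp]

lemma firstHitE_of_notMem (n : ℕ) {x : V} (y : V) (hx : x ∉ A \ {y}) :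
    firstHitE p A y n x = 0 := by
  simp [firstHitE, kernE_of_notMem n _ hx]

lemma firstHitE_zero {x y : V} (hx : x ∈ A) (hxy : x ≠ y) (hy : y ∈ A) :
    firstHitE p A y 0 x = p (y - x) := by
  rw [firstHitE, tsum_eq_single x]
  · simp [kernE, hx, hxy, hy]
  · intro z hz
    simp [kernE, hz.symm]

lemma firstHitE_succ {x y : V} (hx : x ∈ A) (hxy : x ≠ y) (n : ℕ) :
    firstHitE p A y (n + 1) x = ∑' z, p (z - x) * firstHitE p A y n z := by
  have hx' : x ∈ A \ {y} := ⟨hx, hxy⟩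
  simp only [firstHitE, kernE, hx', if_true, ← ENNReal.tsum_mul_left, ← ENNReal.tsum_mul_right]
  rw [ENNReal.tsum_comm]
  simp only [mul_assoc]

lemma hitE_self {y : V} (hy : y ∈ A) : hitE p A y y = 1 := by
  simp [hitE, hy, firstHitE_of_notMem]

lemma hitE_eq_tsum {x y : V} (hx : x ∈ A) (hxy : x ≠ y) (hy : y ∈ A) :
    hitE p A x y = ∑' z, p (z - x) * hitE p A z y := by
  simp only [hitE, hxy, false_and, if_false, zero_add, mul_add, ENNReal.tsum_add]
  rw [tsum_eq_zero_add' ENNReal.summable, firstHitE_zero hx hxy hy]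
  congr 1
  · rw [tsum_eq_single y]
    · simp [hy]
    · intro z hz
      simp [hz]
  · simp only [firstHitE_succ hx hxy, ← ENNReal.tsum_mul_left]
    exact ENNReal.tsum_comm

/-- Minimality of the hitting probability among superharmonic functions. -/
lemma mul_hitE_le {y : V} {h : V → ℝ≥0∞} {c : ℝ≥0∞} (hc : c ≤ h y)
    (hh : ∀ x ∈ A, x ≠ y → ∑' z, p (z - x) * h z ≤ h x) (x : V) :
    c * hitE p A x y ≤ h x := by
  by_cases hy : y ∈ A
  swap
  · have : hitE p A x y = 0 := by
      have h1 : ¬ (x = y ∧ x ∈ A) := by rintro ⟨rfl, h⟩; exact hy h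
      simp [hitE, firstHitE, hy, h1]
    simp [this]
  have key : ∀ (N : ℕ) (x : V),
      c * ((if x = y ∧ x ∈ A then 1 else 0) + ∑ n ∈ Finset.range N, firstHitE p A y n x)
        ≤ h x := by
    intro N
    induction N with
    | zero =>
      intro x
      by_cases hx : x = y
      · subst hx; simpa [hy] using hc
      · simp [hx]
    | succ N ih =>
      intro x
      by_cases hx : x = y
      · subst hx
        simpa [hy, firstHitE_of_notMem] using hc
      by_cases hxA : x ∈ A
      swap
      · simp [hx, firstHitE_of_notMem (A := A) _ y (fun h => hxA h.1)]
      refine le_trans ?_ (hh x hxA hx)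
      refine le_trans (le_of_eq ?_) (ENNReal.tsum_le_tsum fun z => mul_le_mul_right (ih z) _)
      simp only [hx, false_and, if_false, zero_add]
      rw [Finset.sum_range_succ', firstHitE_zero hxA hx hy]
      simp only [firstHitE_succ hxA hx, mul_left_comm _ c, ENNReal.tsum_mul_left, mul_add,
        ENNReal.tsum_add, Finset.mul_sum]
      rw [add_comm]
      congr 1
      · rw [tsum_eq_single y]
        · simp [hy]
        · intro z hz
          simp [hz]
      · rw [Summable.tsum_finsetSum fun _ _ => ENNReal.summable]
        simp only [ENNReal.tsum_mul_left]
  rw [hitE, ENNReal.tsum_eq_iSup_nat, ENNReal.add_iSup, ENNReal.mul_iSup]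
  exact iSup_le fun N => key N x

lemma hitE_le_one (hp : ∑' z, p z = 1) (x y : V) : hitE p A x y ≤ 1 := by
  have := mul_hitE_le (p := p) (A := A) (y := y) (h := fun _ => 1) (c := 1) le_rfl
    (fun x _ _ => by simp [tsum_sub_eq, hp]) x
  simpa using this

lemma tsum_mul_hitE_le (hp : ∑' z, p z = 1) {x y : V} (hx : x ∈ A) (hy : y ∈ A) :
    ∑' z, p (z - x) * hitE p A z y ≤ hitE p A x y := by
  by_cases hxy : x = y
  · subst hxy
    rw [hitE_self hx]
    calc _ ≤ ∑' z, p (z - x) * 1 := by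
          gcongr
          exact hitE_le_one hp _ _
      _ ≤ 1 := by simp [tsum_sub_eq, hp]
  · exact (hitE_eq_tsum hx hxy hy).ge

lemma hitE_mul_hitE_le (hp : ∑' z, p z = 1) (x z : V) {y : V} (hy : y ∈ A) :
    hitE p A x z * hitE p A z y ≤ hitE p A x y := by
  rw [mul_comm]
  exact mul_hitE_le (h := fun x => hitE p A x y) le_rfl
    (fun x hx _ => tsum_mul_hitE_le hp hx hy) x

lemma hitE_le_hitE_add {w : V} (hw : ∀ x ∈ A, x + w ∈ A) (x : V) {y : V} (hy : y ∈ A) :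
    hitE p A x y ≤ hitE p A (x + w) (y + w) := by
  have := mul_hitE_le (p := p) (A := A) (y := y) (h := fun x => hitE p A (x + w) (y + w))
    (c := 1) (by simp [hitE_self (hw y hy)]) (fun x hx hxy => ?_) x
  · simpa using this
  · rw [hitE_eq_tsum (hw x hx) (by simpa using hxy) (hw y hy),
      ← (Equiv.addRight w).tsum_eq fun z => p (z - (x + w)) * hitE p A z (y + w)]
    simp

lemma kernE_le_hitE (hp : ∑' z, p z = 1) {C : Set V} (hC : C ⊆ A) (n : ℕ) (x y : V) :
    kernE p C n x y ≤ hitE p A x y := by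
  by_cases hy : y ∈ C
  swap
  · simp [kernE_eq_zero_of_target_notMem n x hy]
  induction n generalizing x with
  | zero =>
    by_cases h : x = y
    · subst h; simp [kernE, hy, hitE_self (hC hy)]
    · simp [kernE, h]
  | succ n ih =>
    by_cases hx : x ∈ C
    swap
    · simp [kernE, hx]
    refine le_trans ?_ (tsum_mul_hitE_le hp (hC hx) (hC hy))
    simp only [kernE, hx, if_true]
    gcongr
    exact ih _

lemma hitE_pos_of_path (hp : ∑' z, p z = 1) {k : ℕ} {c : ℕ → V} (hcA : ∀ j ≤ k, c j ∈ A)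
    (hc : ∀ j < k, 0 < p (c (j + 1) - c j)) : 0 < hitE p A (c 0) (c k) := by
  induction k generalizing c with
  | zero => simp [hitE_self (hcA 0 le_rfl)]
  | succ k ih =>
    have h1 := ih (c := fun j => c (j + 1)) (fun j hj => hcA _ (by lia)) fun j hj => hc _ (by lia)
    refine lt_of_lt_of_le ?_ (tsum_mul_hitE_le hp (hcA 0 (by lia)) (hcA (k + 1) le_rfl))
    refine lt_of_lt_of_le ?_ (ENNReal.le_tsum (c 1))
    exact ENNReal.mul_pos (hc 0 (by lia)).ne' h1.ne'

lemma kern_eq_toReal {ν : V → ℝ} (hν : ∀ z, 0 ≤ ν z)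
    (hp : ∑' z, ENNReal.ofReal (ν z) = 1) (n : ℕ) (x y : V) :
    kern ν A n x y = (kernE (fun z => ENNReal.ofReal (ν z)) A n x y).toReal := by
  induction n generalizing x with
  | zero => simp only [kern, kernE]; split_ifs <;> simp
  | succ n ih =>
    simp only [kern, kernE]
    rw [ENNReal.tsum_toReal_eq]
    · congr 1
      ext z
      rw [ENNReal.toReal_mul, ih]
      split_ifs <;> simp [hν]
    · intro z
      refine ENNReal.mul_ne_top (by split_ifs <;> simp) ?_
      exact ((kernE_le_one hp n z y).trans_lt ENNReal.one_lt_top).ne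

lemma hitProb_eq_toReal {ν : V → ℝ} (hν : ∀ z, 0 ≤ ν z)
    (hp : ∑' z, ENNReal.ofReal (ν z) = 1) (x y : V) :
    hitProb ν A x y = (hitE (fun z => ENNReal.ofReal (ν z)) A x y).toReal := by
  have hfin := hitE_le_one (A := A) hp x y
  have h1 : ∑' n, firstHitE (fun z => ENNReal.ofReal (ν z)) A y n x ≠ ⊤ :=
    ((le_add_self.trans hfin).trans_lt ENNReal.one_lt_top).ne
  rw [hitE, ENNReal.toReal_add (by split_ifs <;> simp) h1, hitProb,
    ENNReal.tsum_toReal_eq (fun n => ENNReal.ne_top_of_tsum_ne_top h1 n)]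
  congr 1
  · split_ifs <;> simp
  · congr 1
    ext n
    rw [firstHitE, ENNReal.tsum_toReal_eq]
    · congr 1
      ext z
      rw [ENNReal.toReal_mul, kern_eq_toReal hν hp]
      split_ifs <;> simp [hν]
    · exact ENNReal.ne_top_of_tsum_ne_top (ENNReal.ne_top_of_tsum_ne_top h1 n)

end Hitting

/-! ### Exponential weights on `ℤ^ι` -/

section Lattice

variable {ι : Type*} [Fintype ι]

/-- `a · z` for `a ∈ ℝ^ι`, `z ∈ ℤ^ι`. -/
def pairing (a : ι → ℝ) (z : ι → ℤ) : ℝ := a ⬝ᵥ fun i => (z i : ℝ)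

lemma pairing_add_right (a : ι → ℝ) (x y : ι → ℤ) :
    pairing a (x + y) = pairing a x + pairing a y := by
  simp [pairing, dotProduct, mul_add, Finset.sum_add_distrib]

lemma pairing_sub_right (a : ι → ℝ) (x y : ι → ℤ) :
    pairing a (x - y) = pairing a x - pairing a y := by
  simp [pairing, dotProduct, mul_sub, Finset.sum_sub_distrib]

lemma pairing_sub_smul (a l : ι → ℝ) (t : ℝ) (z : ι → ℤ) :
    pairing (a - t • l) z = pairing a z - t * pairing l z := by
  simp [pairing, sub_dotProduct]

lemma pairing_smul (s : ℝ) (a : ι → ℝ) (z : ι → ℤ) :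
    pairing (s • a) z = s * pairing a z := by
  simp [pairing]

/-- `exp (a · z)` with values in `ℝ≥0∞`. -/
noncomputable def expE (a : ι → ℝ) (z : ι → ℤ) : ℝ≥0∞ := ENNReal.ofReal (Real.exp (pairing a z))

/-- The jump generating function. -/
noncomputable def mgfE (p : (ι → ℤ) → ℝ≥0∞) (a : ι → ℝ) : ℝ≥0∞ := ∑' z, p z * expE a z

lemma tsum_mul_expE (p : (ι → ℤ) → ℝ≥0∞) (a : ι → ℝ) (x : ι → ℤ) :
    ∑' z, p (z - x) * expE a z = mgfE p a * expE a x := by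
  rw [mgfE, ← tsum_sub_eq (fun z => p z * expE a z) x, ← ENNReal.tsum_mul_right]
  congr 1
  ext z
  rw [mul_assoc, expE, expE, expE, ← ENNReal.ofReal_mul (Real.exp_pos _).le, ← Real.exp_add,
    pairing_sub_right, sub_add_cancel]

/-- The function `exp (a · x) - ∑ j, exp (b j · x)` grows at least like `mgfE p a ^ n` along the
walk killed outside `C`, as soon as it is nonpositive outside `C`. -/
lemma mgfE_pow_mul_expE_le {κ : Type*} [Fintype κ] {p : (ι → ℤ) → ℝ≥0∞} {C : Set (ι → ℤ)}
    {a : ι → ℝ} {b : κ → ι → ℝ} (hb : ∀ j, mgfE p (b j) ≤ mgfE p a)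
    (hC : ∀ x ∉ C, ∃ j, pairing a x ≤ pairing (b j) x) (n : ℕ) (x : ι → ℤ) :
    mgfE p a ^ n * expE a x ≤
      ∑' y, kernE p C n x y * expE a y + mgfE p a ^ n * ∑ j, expE (b j) x := by
  induction n generalizing x with
  | zero =>
    by_cases hx : x ∈ C
    · refine le_add_right ?_
      refine le_trans ?_ (ENNReal.le_tsum x)
      simp [kernE, hx]
    · obtain ⟨j, hj⟩ := hC x hx
      refine le_add_left ?_
      gcongr
      refine le_trans ?_ (Finset.single_le_sum (f := fun j => expE (b j) x)
        (fun _ _ => zero_le) (Finset.mem_univ j))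
      exact ENNReal.ofReal_le_ofReal (Real.exp_le_exp.2 hj)
  | succ n ih =>
    by_cases hx : x ∈ C
    · have h1 : ∑' y, kernE p C (n + 1) x y * expE a y =
          ∑' z, p (z - x) * ∑' y, kernE p C n z y * expE a y := by
        simp only [kernE, hx, if_true, ← ENNReal.tsum_mul_left, ← ENNReal.tsum_mul_right]
        rw [ENNReal.tsum_comm]
        simp only [mul_assoc]
      have h2 : ∑' z, p (z - x) * (mgfE p a ^ n * ∑ j, expE (b j) z) ≤
          mgfE p a ^ (n + 1) * ∑ j, expE (b j) x := by
        simp only [mul_left_comm _ (mgfE p a ^ n), Finset.mul_sum]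
        rw [Summable.tsum_finsetSum fun _ _ => ENNReal.summable]
        refine Finset.sum_le_sum fun j _ => ?_
        rw [ENNReal.tsum_mul_left, tsum_mul_expE, pow_succ, mul_assoc]
        gcongr
        exact hb j
      calc mgfE p a ^ (n + 1) * expE a x
          = ∑' z, p (z - x) * (mgfE p a ^ n * expE a z) := by
            simp only [mul_left_comm _ (mgfE p a ^ n), ENNReal.tsum_mul_left, tsum_mul_expE]
            ring
        _ ≤ ∑' z, p (z - x) * (∑' y, kernE p C n z y * expE a y
              + mgfE p a ^ n * ∑ j, expE (b j) z) := by
            gcongr with z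
            exact ih z
        _ = ∑' z, p (z - x) * ∑' y, kernE p C n z y * expE a y
              + ∑' z, p (z - x) * (mgfE p a ^ n * ∑ j, expE (b j) z) := by
            simp only [mul_add, ENNReal.tsum_add]
        _ ≤ _ := by
            rw [h1]
            gcongr
    · obtain ⟨j, hj⟩ := hC x hx
      refine le_add_left ?_
      gcongr
      refine le_trans ?_ (Finset.single_le_sum (f := fun j => expE (b j) x)
        (fun _ _ => zero_le) (Finset.mem_univ j))
      exact ENNReal.ofReal_le_ofReal (Real.exp_le_exp.2 hj)

/-- The exponential moment of the hitting points diverges. -/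
lemma tsum_hitE_mul_expE_eq_top {κ : Type*} [Fintype κ] {p : (ι → ℤ) → ℝ≥0∞}
    (hp : ∑' z, p z = 1) {A C : Set (ι → ℤ)} (hCA : C ⊆ A)
    {a : ι → ℝ} {b : κ → ι → ℝ} (hb : ∀ j, mgfE p (b j) ≤ mgfE p a)
    (ha : 1 < mgfE p a) (hfin : mgfE p a ≠ ⊤)
    (hC : ∀ x ∉ C, ∃ j, pairing a x ≤ pairing (b j) x)
    {x : ι → ℤ} (hx : ∑ j, expE (b j) x < expE a x) :
    ∑' y, C.indicator (fun y => hitE p A x y * expE a y) y = ⊤ := by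
  have h1 : ∀ n : ℕ, mgfE p a ^ n * (expE a x - ∑ j, expE (b j) x) ≤
      ∑' y, C.indicator (fun y => hitE p A x y * expE a y) y := by
    intro n
    rw [ENNReal.mul_sub fun _ _ => ENNReal.pow_ne_top hfin, tsub_le_iff_right]
    refine (mgfE_pow_mul_expE_le hb hC n x).trans ?_
    gcongr with y
    by_cases hy : y ∈ C
    · rw [Set.indicator_of_mem hy]
      gcongr
      exact kernE_le_hitE hp hCA n x y
    · simp [kernE_eq_zero_of_target_notMem n x hy]
  have h2 : Tendsto (fun n : ℕ => mgfE p a ^ n * (expE a x - ∑ j, expE (b j) x)) atTop (𝓝 ⊤) := by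
    have h3 := ENNReal.Tendsto.mul_const (b := expE a x - ∑ j, expE (b j) x)
      (ENNReal.tendsto_pow_atTop_nhds_top_iff.2 ha) (Or.inl ENNReal.top_ne_zero)
    rwa [ENNReal.top_mul (tsub_pos_of_lt hx).ne'] at h3
  exact top_le_iff.1 (le_of_tendsto' h2 h1)

lemma summable_exp_neg_mul_sum_abs {c : ℝ} (hc : 0 < c) :
    Summable fun y : ι → ℤ => Real.exp (-c * ∑ i, |(y i : ℝ)|) := by
  have h1 : Summable fun m : ℤ => Real.exp (-c * |(m : ℝ)|) := by
    have h0 : Summable fun n : ℕ => Real.exp (-c * n) := by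
      have := Real.summable_exp_nat_mul_iff.2 (neg_lt_zero.2 hc)
      simpa [mul_comm] using this
    refine Summable.of_nat_of_neg ?_ ?_ <;> simpa using h0
  have h2 : ∀ y : ι → ℤ, Real.exp (-c * ∑ i, |(y i : ℝ)|) =
      ∏ i, Real.exp (-c * |(y i : ℝ)|) := by
    intro y
    rw [← Real.exp_sum, Finset.mul_sum]
  refine summable_of_sum_le (c := (∑' m : ℤ, Real.exp (-c * |(m : ℝ)|)) ^ Fintype.card ι)
    (fun _ => (Real.exp_pos _).le) fun s => ?_
  have h3 : s ⊆ Fintype.piFinset fun i => s.image fun y => y i := by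
    intro y hy
    rw [Fintype.mem_piFinset]
    exact fun i => Finset.mem_image_of_mem _ hy
  calc ∑ y ∈ s, Real.exp (-c * ∑ i, |(y i : ℝ)|)
      ≤ ∑ y ∈ Fintype.piFinset fun i => s.image fun y : ι → ℤ => y i,
          Real.exp (-c * ∑ i, |(y i : ℝ)|) :=
        Finset.sum_le_sum_of_subset_of_nonneg h3 fun _ _ _ => (Real.exp_pos _).le
    _ = ∏ i, ∑ m ∈ s.image fun y : ι → ℤ => y i, Real.exp (-c * |(m : ℝ)|) := by
        rw [Finset.prod_univ_sum]
        exact Finset.sum_congr rfl fun y _ => h2 y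
    _ ≤ ∏ _i : ι, ∑' m : ℤ, Real.exp (-c * |(m : ℝ)|) := by
        refine Finset.prod_le_prod (fun _ _ => Finset.sum_nonneg fun _ _ => (Real.exp_pos _).le) ?_
        exact fun i _ => h1.sum_le_tsum _ fun _ _ => (Real.exp_pos _).le
    _ = _ := by simp

end Lattice

/-! ### Second order expansion of the jump generating function -/

section Moments

variable {ι : Type*} [Fintype ι]

/-- The real-valued jump generating function. -/
noncomputable def mgfR (ν : (ι → ℤ) → ℝ) (a : ι → ℝ) : ℝ :=
  ∑' z, ν z * Real.exp (pairing a z)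

/-- The second moment of `c · z`. -/
noncomputable def secondMoment (ν : (ι → ℤ) → ℝ) (c : ι → ℝ) : ℝ :=
  ∑' z, ν z * pairing c z ^ 2

/-- Exponential moments are finite near the origin. -/
def HasExpMoments (ν : (ι → ℤ) → ℝ) : Prop :=
  ∃ δ > 0, ∀ a : ι → ℝ, (∀ i, |a i| ≤ δ) → Summable fun z => ν z * Real.exp (pairing a z)

variable {ν : (ι → ℤ) → ℝ}

lemma eventually_abs_smul_le (c : ι → ℝ) {δ : ℝ} (hδ : 0 < δ) :
    ∀ᶠ s : ℝ in 𝓝[>] 0, ∀ i, |(s • c) i| ≤ δ := by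
  refine eventually_all.2 fun i => nhdsWithin_le_nhds ?_
  have h : Tendsto (fun s : ℝ => |(s • c) i|) (𝓝 0) (𝓝 |((0 : ℝ) • c) i|) :=
    Continuous.tendsto (by simp only [Pi.smul_apply, smul_eq_mul]; fun_prop) 0
  simp only [zero_smul, Pi.zero_apply, abs_zero] at h
  exact h.eventually_le_const hδ

lemma HasExpMoments.exists_summable_abs (hν : ∀ z, 0 ≤ ν z) (h : HasExpMoments ν) (c : ι → ℝ) :
    ∃ s > 0, Summable fun z => ν z * Real.exp (s * |pairing c z|) := by
  obtain ⟨δ, hδ, hs⟩ := h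
  obtain ⟨s, hsδ, hs0⟩ := ((eventually_abs_smul_le c hδ).and self_mem_nhdsWithin).exists
  refine ⟨s, hs0, ?_⟩
  have h1 := hs (s • c) hsδ
  have h2 := hs (-s • c) (by simpa using hsδ)
  refine Summable.of_nonneg_of_le (fun z => mul_nonneg (hν z) (Real.exp_pos _).le) (fun z => ?_)
    (h1.add h2)
  simp only [pairing_smul]
  rw [← mul_add]
  refine mul_le_mul_of_nonneg_left ?_ (hν z)
  have e1 := Real.exp_pos (s * pairing c z)
  have e2 := Real.exp_pos (-s * pairing c z)
  rcases abs_cases (pairing c z) with ⟨h, _⟩ | ⟨h, _⟩ <;> rw [h]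
  · linarith
  · rw [mul_neg, ← neg_mul]; linarith

lemma pow_le_factorial_div_mul_exp {s : ℝ} (hs : 0 < s) (n : ℕ) {t : ℝ} (ht : 0 ≤ t) :
    t ^ n ≤ n.factorial / s ^ n * Real.exp (s * t) := by
  have h := Real.pow_div_factorial_le_exp (x := s * t) (by positivity) n
  rw [div_le_iff₀ (by positivity), mul_pow] at h
  rw [div_mul_eq_mul_div, le_div_iff₀ (by positivity)]
  linarith

lemma HasExpMoments.summable_sq (hν : ∀ z, 0 ≤ ν z) (h : HasExpMoments ν) (c : ι → ℝ) :
    Summable fun z => ν z * pairing c z ^ 2 := by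
  obtain ⟨s, hs, hsum⟩ := h.exists_summable_abs hν c
  refine Summable.of_nonneg_of_le (fun z => mul_nonneg (hν z) (sq_nonneg _)) (fun z => ?_)
    (hsum.mul_left ((2 : ℕ).factorial / s ^ 2))
  have := mul_le_mul_of_nonneg_left
    (pow_le_factorial_div_mul_exp hs 2 (abs_nonneg (pairing c z))) (hν z)
  rw [sq_abs] at this
  linarith

lemma abs_exp_sub_quadratic_le (x : ℝ) :
    |Real.exp x - (1 + x + x ^ 2 / 2)| ≤ |x| ^ 3 * Real.exp |x| := by
  have h := Complex.norm_exp_sub_sum_le_norm_mul_exp (x : ℂ) 3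
  have e : Complex.exp (x : ℂ) - ∑ m ∈ Finset.range 3, (x : ℂ) ^ m / (m.factorial : ℂ) =
      ((Real.exp x - (1 + x + x ^ 2 / 2) : ℝ) : ℂ) := by
    simp [Finset.sum_range_succ, Nat.factorial]
  rw [e, Complex.norm_real, Complex.norm_real] at h
  exact h

/-- Second order expansion of the jump generating function at the origin for a centred jump
distribution. -/
lemma HasExpMoments.abs_mgfR_sub_le (hν : ∀ z, 0 ≤ ν z) (h : HasExpMoments ν)
    (h1 : HasSum ν 1) (h0 : ∀ i, HasSum (fun z => ν z * (z i : ℝ)) 0) (c : ι → ℝ) :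
    ∃ B, ∀ᶠ s : ℝ in 𝓝[>] 0,
      |mgfR ν (s • c) - (1 + s ^ 2 * (secondMoment ν c / 2))| ≤ B * s ^ 3 := by
  have hmean : HasSum (fun z => ν z * pairing c z) 0 := by
    have := hasSum_sum (s := Finset.univ) fun i _ => (h0 i).mul_left (c i)
    simp only [mul_zero, Finset.sum_const_zero] at this
    refine this.congr_fun fun z => ?_
    simp only [pairing, dotProduct, Finset.mul_sum]
    exact Finset.sum_congr rfl fun i _ => by ring
  have hsq : HasSum (fun z => ν z * pairing c z ^ 2) (secondMoment ν c) :=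
    (h.summable_sq hν c).hasSum
  obtain ⟨s₀, hs₀, hsum⟩ := h.exists_summable_abs hν c
  obtain ⟨δ, hδ, hδs⟩ := h
  set K : ℝ := (3 : ℕ).factorial / (s₀ / 2) ^ 3 with hK
  refine ⟨K * ∑' z, ν z * Real.exp (s₀ * |pairing c z|), ?_⟩
  have hsmall : ∀ᶠ s : ℝ in 𝓝[>] 0, s ≤ s₀ / 2 :=
    nhdsWithin_le_nhds (tendsto_id.eventually_le_const (half_pos hs₀))
  filter_upwards [eventually_abs_smul_le c hδ, hsmall, self_mem_nhdsWithin] with s hsδ hs hs0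
  have hs0 : 0 < s := hs0
  have hm : HasSum (fun z => ν z * Real.exp (pairing (s • c) z)) (mgfR ν (s • c)) :=
    (hδs _ hsδ).hasSum
  have hdiff := hm.sub ((h1.add (hmean.mul_left s)).add (hsq.mul_left (s ^ 2 / 2)))
  have hbound : ∀ z, ‖ν z * Real.exp (pairing (s • c) z) -
      (ν z + s * (ν z * pairing c z) + s ^ 2 / 2 * (ν z * pairing c z ^ 2))‖ ≤
      s ^ 3 * K * (ν z * Real.exp (s₀ * |pairing c z|)) := by
    intro z
    have e : ν z * Real.exp (pairing (s • c) z) -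
        (ν z + s * (ν z * pairing c z) + s ^ 2 / 2 * (ν z * pairing c z ^ 2)) =
        ν z * (Real.exp (s * pairing c z) -
          (1 + s * pairing c z + (s * pairing c z) ^ 2 / 2)) := by
      rw [pairing_smul]; ring
    rw [e, norm_mul, Real.norm_of_nonneg (hν z), Real.norm_eq_abs]
    have h2 := abs_exp_sub_quadratic_le (s * pairing c z)
    rw [abs_mul, abs_of_pos hs0] at h2
    set t := |pairing c z|
    have ht : 0 ≤ t := abs_nonneg _
    have h3 : (s * t) ^ 3 * Real.exp (s * t) ≤ s ^ 3 * K * Real.exp (s₀ * t) := by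
      have h4 := pow_le_factorial_div_mul_exp (half_pos hs₀) 3 ht
      have h5 : Real.exp (s * t) ≤ Real.exp (s₀ / 2 * t) := by gcongr
      have h6 : Real.exp (s₀ * t) = Real.exp (s₀ / 2 * t) * Real.exp (s₀ / 2 * t) := by
        rw [← Real.exp_add]; ring_nf
      calc (s * t) ^ 3 * Real.exp (s * t) = s ^ 3 * (t ^ 3 * Real.exp (s * t)) := by ring
        _ ≤ s ^ 3 * ((K * Real.exp (s₀ / 2 * t)) * Real.exp (s₀ / 2 * t)) := by gcongr
        _ = _ := by rw [h6]; ring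
    calc _ ≤ ν z * (s ^ 3 * K * Real.exp (s₀ * t)) :=
          mul_le_mul_of_nonneg_left (h2.trans h3) (hν z)
      _ = _ := by ring
  have hfinal := tsum_of_norm_bounded (hsum.hasSum.mul_left (s ^ 3 * K)) hbound
  rw [hdiff.tsum_eq, Real.norm_eq_abs] at hfinal
  convert hfinal using 1
  · congr 1; ring
  · ring

lemma HasExpMoments.eventually_mgfR_lt (hν : ∀ z, 0 ≤ ν z) (h : HasExpMoments ν)
    (h1 : HasSum ν 1) (h0 : ∀ i, HasSum (fun z => ν z * (z i : ℝ)) 0) {c c' : ι → ℝ}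
    (hcc : secondMoment ν c < secondMoment ν c') :
    ∀ᶠ s : ℝ in 𝓝[>] 0, mgfR ν (s • c) < mgfR ν (s • c') := by
  obtain ⟨B, hB⟩ := h.abs_mgfR_sub_le hν h1 h0 c
  obtain ⟨B', hB'⟩ := h.abs_mgfR_sub_le hν h1 h0 c'
  have hlim : ∀ᶠ s : ℝ in 𝓝[>] 0, (B + B') * s < (secondMoment ν c' - secondMoment ν c) / 2 := by
    refine nhdsWithin_le_nhds ?_
    have : Tendsto (fun s : ℝ => (B + B') * s) (𝓝 0) (𝓝 ((B + B') * 0)) :=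
      Continuous.tendsto (by fun_prop) 0
    rw [mul_zero] at this
    exact this.eventually_lt_const (by linarith)
  filter_upwards [hB, hB', hlim, self_mem_nhdsWithin] with s hs hs' hl hs0
  have hs0 : 0 < s := hs0
  have h2 := (abs_le.1 hs).2
  have h3 := (abs_le.1 hs').1
  have h4 := mul_lt_mul_of_pos_left hl (pow_pos hs0 2)
  nlinarith

/-- The matrix of second moments. -/
noncomputable def covMatrix (ν : (ι → ℤ) → ℝ) : Matrix ι ι ℝ :=
  Matrix.of fun i k => ∑' z, ν z * ((z i : ℝ) * (z k : ℝ))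

lemma HasExpMoments.hasSum_covMatrix (hν : ∀ z, 0 ≤ ν z) (h : HasExpMoments ν) (c c' : ι → ℝ) :
    HasSum (fun z => ν z * (pairing c z * pairing c' z)) (c ⬝ᵥ (covMatrix ν).mulVec c') := by
  have hentry : ∀ i k, Summable fun z : ι → ℤ => ν z * ((z i : ℝ) * (z k : ℝ)) := by
    intro i k
    have hi := h.summable_sq hν (Pi.single i 1)
    have hk := h.summable_sq hν (Pi.single k 1)
    simp only [pairing, single_dotProduct, one_mul] at hi hk
    refine Summable.of_norm_bounded (hi.add hk) fun z => ?_
    rw [norm_mul, Real.norm_of_nonneg (hν z), ← mul_add]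
    refine mul_le_mul_of_nonneg_left ?_ (hν z)
    rw [Real.norm_eq_abs, abs_le]
    constructor <;> nlinarith [sq_nonneg ((z i : ℝ) + z k), sq_nonneg ((z i : ℝ) - z k)]
  have := hasSum_sum (s := Finset.univ) fun i _ =>
    (hasSum_sum (s := Finset.univ) fun k _ => ((hentry i k).hasSum.mul_left (c' k))).mul_left (c i)
  have e : c ⬝ᵥ (covMatrix ν).mulVec c' =
      ∑ i, c i * ∑ k, c' k * ∑' z, ν z * ((z i : ℝ) * (z k : ℝ)) := by
    simp only [dotProduct, Matrix.mulVec, covMatrix, Matrix.of_apply, mul_comm]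
  rw [e]
  refine this.congr_fun fun z => ?_
  simp only [pairing, dotProduct]
  rw [Finset.sum_mul_sum]
  simp only [Finset.mul_sum]
  exact Finset.sum_congr rfl fun i _ => Finset.sum_congr rfl fun k _ => by ring

lemma secondMoment_pos (hν : ∀ z, 0 ≤ ν z) (h : HasExpMoments ν)
    (hnd : ∀ b : ι → ℝ, (∀ z, 0 < ν z → pairing b z = 0) → b = 0) {c : ι → ℝ} (hc : c ≠ 0) :
    0 < secondMoment ν c := by
  have hnn : ∀ z, 0 ≤ ν z * pairing c z ^ 2 := fun z => mul_nonneg (hν z) (sq_nonneg _)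
  refine lt_of_le_of_ne (tsum_nonneg hnn) fun h0 => hc (hnd c fun z hz => ?_)
  have h1 := (hasSum_zero_iff_of_nonneg hnn).1 (by
    rw [h0]
    exact (h.summable_sq hν c).hasSum)
  have h2 := congrFun h1 z
  simpa [hz.ne'] using h2

/-- Tilting parameters for which the drift points into the cone `{l j > 0}`. -/
lemma HasExpMoments.exists_tilt (hν : ∀ z, 0 ≤ ν z) (h : HasExpMoments ν)
    (h1 : HasSum ν 1) (h0 : ∀ i, HasSum (fun z => ν z * (z i : ℝ)) 0)
    (hnd : ∀ b : ι → ℝ, (∀ z, 0 < ν z → pairing b z = 0) → b = 0)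
    {κ : Type*} [Finite κ] {v : ι → ℝ} (hv : v ≠ 0) {l : κ → ι → ℝ} (hl : ∀ j, 0 < l j ⬝ᵥ v)
    {α : ℝ} (hα : 0 < α) :
    ∃ a : ι → ℝ, ∃ θ : ℝ, 0 < θ ∧ (∀ i, |a i| ≤ α) ∧ 1 < mgfR ν a ∧
      (Summable fun z => ν z * Real.exp (pairing a z)) ∧
      ∀ j, mgfR ν (a - θ • l j) ≤ mgfR ν a ∧
        Summable fun z => ν z * Real.exp (pairing (a - θ • l j) z) := by
  have hinj : Function.Injective (covMatrix ν).mulVecLin := by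
    rw [← LinearMap.ker_eq_bot, LinearMap.ker_eq_bot']
    intro c hc
    by_contra hne
    have hpos := secondMoment_pos hν h hnd hne
    have hs := h.hasSum_covMatrix hν c c
    rw [Matrix.mulVecLin_apply] at hc
    rw [hc, dotProduct_zero] at hs
    simp only [← sq] at hs
    rw [secondMoment, hs.tsum_eq] at hpos
    exact hpos.false
  obtain ⟨b, hb⟩ := LinearMap.injective_iff_surjective.1 hinj v
  rw [Matrix.mulVecLin_apply] at hb
  have hb0 : b ≠ 0 := by
    rintro rfl
    exact hv (by simpa using hb.symm)
  have hquad : ∀ (j : κ) (t : ℝ), secondMoment ν (b - t • l j) =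
      secondMoment ν b - 2 * t * (l j ⬝ᵥ v) + t ^ 2 * secondMoment ν (l j) := by
    intro j t
    have e1 := h.hasSum_covMatrix hν (l j) b
    rw [hb] at e1
    have e2 := (((h.summable_sq hν b).hasSum.sub (e1.mul_left (2 * t))).add
      ((h.summable_sq hν (l j)).hasSum.mul_left (t ^ 2))).tsum_eq
    rw [secondMoment, secondMoment, secondMoment, ← e2]
    congr 1
    ext z
    rw [pairing_sub_smul]
    ring
  have ht : ∀ᶠ t : ℝ in 𝓝[>] 0, ∀ j, secondMoment ν (b - t • l j) < secondMoment ν b := by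
    refine eventually_all.2 fun j => ?_
    have hlim : ∀ᶠ t : ℝ in 𝓝[>] 0, t * secondMoment ν (l j) < 2 * (l j ⬝ᵥ v) := by
      refine nhdsWithin_le_nhds ?_
      have : Tendsto (fun t : ℝ => t * secondMoment ν (l j)) (𝓝 0)
          (𝓝 (0 * secondMoment ν (l j))) := Continuous.tendsto (by fun_prop) 0
      rw [zero_mul] at this
      exact this.eventually_lt_const (by linarith [hl j])
    filter_upwards [hlim, self_mem_nhdsWithin] with t ht ht0
    have ht0 : 0 < t := ht0
    rw [hquad]
    nlinarith
  obtain ⟨t, ht, ht0⟩ := (ht.and self_mem_nhdsWithin).exists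
  have ht0 : 0 < t := ht0
  have hzero : mgfR ν 0 = 1 := by
    simpa [mgfR, pairing] using h1.tsum_eq
  have hone : ∀ᶠ s : ℝ in 𝓝[>] 0, mgfR ν (s • (0 : ι → ℝ)) < mgfR ν (s • b) := by
    refine h.eventually_mgfR_lt hν h1 h0 ?_
    simpa [secondMoment, pairing] using secondMoment_pos hν h hnd hb0
  have hlt : ∀ᶠ s : ℝ in 𝓝[>] 0, ∀ j, mgfR ν (s • (b - t • l j)) < mgfR ν (s • b) :=
    eventually_all.2 fun j => h.eventually_mgfR_lt hν h1 h0 (ht j)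
  obtain ⟨δ, hδ, hδs⟩ := h
  obtain ⟨s, hs1, hslt, hsα, hsδ, hsδ', hs0⟩ := (hone.and (hlt.and ((eventually_abs_smul_le b hα).and
    ((eventually_abs_smul_le b hδ).and
      ((eventually_all.2 fun j => eventually_abs_smul_le (b - t • l j) hδ).and
        self_mem_nhdsWithin))))).exists
  have hs0 : 0 < s := hs0
  have e : ∀ j, s • b - (s * t) • l j = s • (b - t • l j) := fun j => by
    rw [smul_sub, smul_smul]
  refine ⟨s • b, s * t, mul_pos hs0 ht0, hsα, ?_, hδs _ hsδ, fun j => ?_⟩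
  · rwa [smul_zero, hzero] at hs1
  · rw [e]
    exact ⟨(hslt j).le, hδs _ (hsδ' j)⟩

lemma mgfE_eq_ofReal (hν : ∀ z, 0 ≤ ν z) {a : ι → ℝ}
    (ha : Summable fun z => ν z * Real.exp (pairing a z)) :
    mgfE (fun z => ENNReal.ofReal (ν z)) a = ENNReal.ofReal (mgfR ν a) := by
  rw [mgfR, ENNReal.ofReal_tsum_of_nonneg (fun z => mul_nonneg (hν z) (Real.exp_pos _).le) ha, mgfE]
  simp only [expE, ENNReal.ofReal_mul (hν _)]

end Moments

/-! ### Hitting probabilities along a coordinate axis -/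

section Axis

variable {ι : Type*}

/-- The open positive orthant of `ℤ^ι`. -/
def orthant (ι : Type*) : Set (ι → ℤ) := {u | ∀ i, 0 < u i}

variable [Fintype ι] {ν : (ι → ℤ) → ℝ}

/-- Inside an arbitrarily narrow cone around a coordinate axis there are points, arbitrarily far
away, whose hitting probability is not exponentially small. -/
lemma HasExpMoments.exists_exp_le_hitE (hν : ∀ z, 0 ≤ ν z) (h : HasExpMoments ν)
    (h1 : HasSum ν 1) (h0 : ∀ i, HasSum (fun z => ν z * (z i : ℝ)) 0)
    (hnd : ∀ b : ι → ℝ, (∀ z, 0 < ν z → pairing b z = 0) → b = 0)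
    (hp : ∑' z, ENNReal.ofReal (ν z) = 1) (i : ι) {N : ℕ} (hN : 1 ≤ N) {ε : ℝ} (hε : 0 < ε) :
    ∃ x ∈ orthant ι, ∀ R : ℝ, ∃ y ∈ orthant ι, (∀ j ≠ i, N * y j < y i) ∧ R ≤ y i ∧
      Real.exp (-(ε * y i)) ≤ (hitE (fun z => ENNReal.ofReal (ν z)) (orthant ι) x y).toReal := by
  have hcard : 0 < (Fintype.card ι : ℝ) := by
    exact_mod_cast Fintype.card_pos_iff.2 ⟨i⟩
  have hNR : (1 : ℝ) ≤ N := by exact_mod_cast hN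
  set c : ℝ := ε / (2 * Fintype.card ι) with hc
  have hc0 : 0 < c := by positivity
  let v : ι → ℤ := fun k => if k = i then 2 * N else 1
  have hv0 : ∀ k, 0 < v k := fun k => by
    simp only [v]; split_ifs <;> lia
  let l : ι ⊕ {j // j ≠ i} → ι → ℝ := Sum.elim (fun k => Pi.single k 1)
    fun j => Pi.single i 1 - (N : ℝ) • Pi.single j.1 1
  have hl_inl : ∀ k z, pairing (l (Sum.inl k)) z = z k := fun k z => by
    simp [l, pairing, single_dotProduct]
  have hl_inr : ∀ j z, pairing (l (Sum.inr j)) z = z i - N * z j.1 := fun j z => by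
    simp [l, pairing, single_dotProduct, sub_dotProduct]
  have hlv : ∀ j, 0 < pairing (l j) v := by
    rintro (k | ⟨j, hj⟩)
    · rw [hl_inl]; exact_mod_cast hv0 k
    · rw [hl_inr]; simp only [v, if_true, hj, if_false]; push_cast; linarith
  have hvne : (fun k => (v k : ℝ)) ≠ 0 := fun hv => by
    have h2 := congrFun hv i
    have h3 := hv0 i
    simp only [Pi.zero_apply, Int.cast_eq_zero] at h2
    lia
  obtain ⟨a, θ, hθ, haα, ha1, has, hal⟩ := h.exists_tilt hν h1 h0 hnd hvne hlv hc0
  obtain ⟨m, hm1, hm⟩ : ∃ m : ℕ, 1 ≤ m ∧ ∑ j, Real.exp (-(θ * pairing (l j) v)) ^ m < 1 := by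
    have hlim : Tendsto (fun m : ℕ => ∑ j, Real.exp (-(θ * pairing (l j) v)) ^ m) atTop
        (𝓝 (∑ _j : ι ⊕ {j // j ≠ i}, 0)) := by
      refine tendsto_finsetSum _ fun j _ => ?_
      refine tendsto_pow_atTop_nhds_zero_of_lt_one (Real.exp_pos _).le ?_
      rw [Real.exp_lt_one_iff]
      exact neg_lt_zero.2 (mul_pos hθ (hlv j))
    rw [Finset.sum_const_zero] at hlim
    exact ((eventually_ge_atTop 1).and (hlim.eventually_lt_const one_pos)).exists
  have hpair : ∀ b : ι → ℝ, pairing b (fun k => m * v k) = m * pairing b v := fun b => by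
    simp only [pairing, dotProduct, Finset.mul_sum]
    refine Finset.sum_congr rfl fun k _ => ?_
    push_cast; ring
  refine ⟨fun k => m * v k, fun k => mul_pos (by exact_mod_cast hm1) (hv0 k), fun R => ?_⟩
  by_contra! hcon
  let C : Set (ι → ℤ) := {y | y ∈ orthant ι ∧ ∀ j ≠ i, N * y j < y i}
  have hCA : C ⊆ orthant ι := fun y hy => hy.1
  have htop := tsum_hitE_mul_expE_eq_top (C := C) (a := a) (b := fun j => a - θ • l j)
    (x := fun k => m * v k) hp hCA ?_ ?_ ?_ ?_ ?_
  · have hbound : ∀ y, C.indicator (fun y => hitE (fun z => ENNReal.ofReal (ν z)) (orthant ι)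
        (fun k => m * v k) y * expE a y) y ≤
        ENNReal.ofReal (Real.exp (ε * |R|) * Real.exp (-c * ∑ k, |(y k : ℝ)|)) := by
      intro y
      by_cases hy : y ∈ C
      swap
      · simp [hy]
      rw [Set.indicator_of_mem hy]
      have hyi : (0 : ℝ) < y i := by exact_mod_cast hy.1 i
      have hle : ∀ k, |(y k : ℝ)| ≤ y i := by
        intro k
        have hk := hy.1 k
        rw [abs_of_pos (by exact_mod_cast hk)]
        by_cases hki : k = i
        · rw [hki]
        · have h2 := hy.2 k hki
          have : y k ≤ N * y k := le_mul_of_one_le_left hk.le (by exact_mod_cast hN)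
          exact_mod_cast this.trans h2.le
      have hsum : ∑ k, |(y k : ℝ)| ≤ Fintype.card ι * y i := by
        calc _ ≤ ∑ _k : ι, (y i : ℝ) := Finset.sum_le_sum fun k _ => hle k
          _ = _ := by simp
      have hcs : c * ∑ k, |(y k : ℝ)| ≤ ε / 2 * y i := by
        calc _ ≤ c * (Fintype.card ι * y i) := by gcongr
          _ = _ := by rw [hc]; field_simp
      have hay : pairing a y ≤ c * ∑ k, |(y k : ℝ)| := by
        rw [pairing, dotProduct, Finset.mul_sum]
        refine Finset.sum_le_sum fun k _ => (le_abs_self _).trans ?_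
        rw [abs_mul]
        exact mul_le_mul_of_nonneg_right (haα k) (abs_nonneg _)
      have hfin := hitE_le_one (A := orthant ι) hp (fun k => m * v k) y
      have hne := (hfin.trans_lt ENNReal.one_lt_top).ne
      have hH : (hitE (fun z => ENNReal.ofReal (ν z)) (orthant ι) (fun k => m * v k) y).toReal ≤
          Real.exp (ε * |R| - ε * y i) := by
        by_cases hR : R ≤ y i
        · refine (hcon y hy.1 hy.2 hR).le.trans (Real.exp_le_exp.2 ?_)
          have := mul_nonneg hε.le (abs_nonneg R)
          linarith
        · refine (ENNReal.toReal_mono ENNReal.one_ne_top hfin).trans ?_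
          rw [ENNReal.toReal_one, Real.one_le_exp_iff, ← mul_sub]
          have := le_abs_self R
          exact mul_nonneg hε.le (by linarith)
      rw [← ENNReal.ofReal_toReal hne, expE, ← ENNReal.ofReal_mul ENNReal.toReal_nonneg]
      refine ENNReal.ofReal_le_ofReal ?_
      calc _ ≤ Real.exp (ε * |R| - ε * y i) * Real.exp (pairing a y) := by gcongr
        _ ≤ _ := by
          rw [← Real.exp_add, ← Real.exp_add, Real.exp_le_exp]
          linarith
    have hlt := ENNReal.tsum_le_tsum hbound
    rw [htop, ← ENNReal.ofReal_tsum_of_nonneg (fun _ => by positivity)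
      ((summable_exp_neg_mul_sum_abs hc0).mul_left _)] at hlt
    exact ENNReal.ofReal_ne_top (top_le_iff.1 hlt)
  · intro j
    rw [mgfE_eq_ofReal hν has, mgfE_eq_ofReal hν (hal j).2]
    exact ENNReal.ofReal_le_ofReal (hal j).1
  · rw [mgfE_eq_ofReal hν has]
    exact ENNReal.one_lt_ofReal.2 ha1
  · rw [mgfE_eq_ofReal hν has]
    exact ENNReal.ofReal_ne_top
  · intro x hx
    have hj : ∃ j, pairing (l j) x ≤ 0 := by
      by_contra! hpos
      refine hx ⟨fun k => ?_, fun j hj => ?_⟩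
      · have := hpos (Sum.inl k)
        rw [hl_inl] at this
        exact_mod_cast this
      · have := hpos (Sum.inr ⟨j, hj⟩)
        rw [hl_inr, sub_pos] at this
        exact_mod_cast this
    obtain ⟨j, hj⟩ := hj
    refine ⟨j, ?_⟩
    rw [pairing_sub_smul]
    nlinarith
  · simp only [expE]
    rw [← ENNReal.ofReal_sum_of_nonneg fun _ _ => (Real.exp_pos _).le]
    refine (ENNReal.ofReal_lt_ofReal_iff (Real.exp_pos _)).2 ?_
    have e : ∀ j, Real.exp (pairing (a - θ • l j) fun k => m * v k) =
        Real.exp (pairing a fun k => m * v k) * Real.exp (-(θ * pairing (l j) v)) ^ m := by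
      intro j
      rw [pairing_sub_smul, ← Real.exp_nat_mul, ← Real.exp_add, hpair (l j)]
      ring_nf
    simp only [e]
    rw [← Finset.mul_sum]
    exact mul_lt_of_lt_one_right (Real.exp_pos _) hm

end Axis

/-! ### Subadditivity -/

section Subadditive

variable {ι : Type*}

lemma nsmul_le_of_subadditive {M : Type*} [AddCommMonoid M] {g : M → ℝ} (g0 : g 0 ≤ 0)
    (gadd : ∀ w w', g (w + w') ≤ g w + g w') (n : ℕ) (w : M) : g (n • w) ≤ n * g w := by
  have := Finset.le_sum_of_subadditive g g0 gadd (Finset.range n) fun _ => w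
  simpa using this

lemma exists_le_mul_add_of_subadditive {g : (ι → ℕ) → ℝ} (g0 : g 0 ≤ 0)
    (gadd : ∀ w w', g (w + w') ≤ g w + g w') (gnn : ∀ w, 0 ≤ g w) (i : ι) {ε : ℝ}
    {n : ℕ} (hn : 1 ≤ n) (hgn : g (Pi.single i n) ≤ ε * n) :
    ∃ K, ∀ k : ℕ, g (Pi.single i k) ≤ ε * k + K := by
  have hε : 0 ≤ ε := by
    have h2 : (0 : ℝ) < n := by exact_mod_cast hn
    exact nonneg_of_mul_nonneg_left ((gnn _).trans hgn) h2
  refine ⟨∑ r ∈ Finset.range n, g (Pi.single i r), fun k => ?_⟩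
  have hk : (Pi.single i k : ι → ℕ) = (k / n) • Pi.single i n + Pi.single i (k % n) := by
    rw [← Pi.single_smul, ← Pi.single_add, smul_eq_mul, mul_comm, Nat.div_add_mod]
  rw [hk]
  refine (gadd _ _).trans (add_le_add ?_ ?_)
  · refine (nsmul_le_of_subadditive g0 gadd _ _).trans ?_
    calc ((k / n : ℕ) : ℝ) * g (Pi.single i n) ≤ (k / n : ℕ) * (ε * n) := by gcongr
      _ = ε * ((n * (k / n) : ℕ) : ℝ) := by push_cast; ring
      _ ≤ ε * k := by
        gcongr
        exact Nat.mul_div_le k n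
  · exact Finset.single_le_sum (f := fun r => g (Pi.single i r)) (fun _ _ => gnn _)
      (Finset.mem_range.2 (Nat.mod_lt _ hn))

variable [Fintype ι]

lemma le_sum_single_of_subadditive {g : (ι → ℕ) → ℝ} (g0 : g 0 ≤ 0)
    (gadd : ∀ w w', g (w + w') ≤ g w + g w') (w : ι → ℕ) :
    g w ≤ ∑ i, g (Pi.single i (w i)) := by
  conv_lhs => rw [← Finset.univ_sum_single w]
  exact Finset.le_sum_of_subadditive g g0 gadd _ _

/-- A translation-monotone hitting cost on the orthant which is sublinear in narrow cones around
the coordinate axes is sublinear in all directions. -/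
lemma exists_le_mul_sum_add {f : (ι → ℤ) → (ι → ℤ) → ℝ}
    (hnn : ∀ x ∈ orthant ι, ∀ y ∈ orthant ι, 0 ≤ f x y)
    (hself : ∀ x ∈ orthant ι, f x x ≤ 0)
    (htri : ∀ x ∈ orthant ι, ∀ z ∈ orthant ι, ∀ y ∈ orthant ι, f x y ≤ f x z + f z y)
    (hadd : ∀ w, 0 ≤ w → ∀ x ∈ orthant ι, ∀ y ∈ orthant ι, f (x + w) (y + w) ≤ f x y)
    (hkey : ∀ (i : ι) (N : ℕ), 1 ≤ N → ∀ ε : ℝ, 0 < ε → ∃ x ∈ orthant ι, ∀ R : ℝ,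
      ∃ y ∈ orthant ι, (∀ j ≠ i, N * y j < y i) ∧ R ≤ y i ∧ f x y ≤ ε * y i)
    {x : ι → ℤ} (hx : x ∈ orthant ι) {ε : ℝ} (hε : 0 < ε) :
    ∃ K, ∀ u ∈ orthant ι, f x u ≤ ε * ∑ i, (u i : ℝ) + K := by
  let nc : (ι → ℕ) → ι → ℤ := fun w i => w i
  have nc_add : ∀ w w', nc (w + w') = nc w + nc w' := fun w w' => by ext; simp [nc]
  have nc_nn : ∀ w, 0 ≤ nc w := fun w i => by simp [nc]
  have hone : (1 : ι → ℤ) ∈ orthant ι := fun i => by simp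
  have hmem : ∀ w, 1 + nc w ∈ orthant ι := fun w i => by
    have := nc_nn w i
    simp only [Pi.zero_apply] at this
    simp only [Pi.add_apply, Pi.one_apply]
    lia
  let up : (ι → ℕ) → ℝ := fun w => f 1 (1 + nc w)
  let dn : (ι → ℕ) → ℝ := fun w => f (1 + nc w) 1
  have hzero : 1 + nc 0 = 1 := by ext; simp [nc]
  have up0 : up 0 ≤ 0 := by simp only [up, hzero]; exact hself 1 hone
  have dn0 : dn 0 ≤ 0 := by simp only [dn, hzero]; exact hself 1 hone
  have up_nn : ∀ w, 0 ≤ up w := fun w => hnn _ hone _ (hmem w)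
  have dn_nn : ∀ w, 0 ≤ dn w := fun w => hnn _ (hmem w) _ hone
  have up_add : ∀ w w', up (w + w') ≤ up w + up w' := fun w w' => by
    refine (htri _ hone _ (hmem w) _ (hmem _)).trans (add_le_add le_rfl ?_)
    have := hadd (nc w) (nc_nn w) _ hone _ (hmem w')
    rwa [add_assoc, add_comm (nc w'), ← nc_add] at this
  have dn_add : ∀ w w', dn (w + w') ≤ dn w + dn w' := fun w w' => by
    refine (htri _ (hmem _) _ (hmem w') _ hone).trans (add_le_add ?_ le_rfl)
    have := hadd (nc w') (nc_nn w') _ (hmem w) _ hone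
    rwa [add_assoc, ← nc_add] at this
  have dn_le : ∀ w : ι → ℕ, dn w ≤ ∑ j, w j * dn (Pi.single j 1) := fun w => by
    refine (le_sum_single_of_subadditive dn0 dn_add w).trans (Finset.sum_le_sum fun j _ => ?_)
    have := nsmul_le_of_subadditive dn0 dn_add (w j) (Pi.single j 1)
    rwa [← Pi.single_smul, smul_eq_mul, mul_one] at this
  have axis : ∀ i, ∃ n : ℕ, 1 ≤ n ∧ up (Pi.single i n) ≤ ε * n := by
    intro i
    set c := ∑ j, dn (Pi.single j 1) with hc
    have hc0 : 0 ≤ c := Finset.sum_nonneg fun _ _ => dn_nn _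
    obtain ⟨N, hN⟩ := exists_nat_ge (max 1 (4 * c / ε))
    have hN1 : 1 ≤ N := by exact_mod_cast (le_max_left _ _).trans hN
    have hNR : (0 : ℝ) < N := by exact_mod_cast hN1
    have hNc : 4 * c ≤ N * ε := by
      rw [← div_le_iff₀ hε]; exact (le_max_right _ _).trans hN
    obtain ⟨x', hx', hR⟩ := hkey i N hN1 (ε / 8) (by positivity)
    obtain ⟨y, hy, hyN, hyR, hfy⟩ := hR (max 2 (f 1 x' / (ε / 8)))
    have hy2 : (2 : ℝ) ≤ y i := (le_max_left _ _).trans hyR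
    have hfx : f 1 x' ≤ y i * (ε / 8) := by
      rw [← div_le_iff₀ (by positivity)]; exact (le_max_right _ _).trans hyR
    have hy2' : 2 ≤ y i := by exact_mod_cast hy2
    obtain ⟨n, hn⟩ := Int.eq_ofNat_of_zero_le (show 0 ≤ y i - 1 by lia)
    have hnR : (y i : ℝ) = n + 1 := by
      have : y i = n + 1 := by lia
      exact_mod_cast this
    let w : ι → ℕ := fun j => if j = i then 0 else (y j - 1).toNat
    have hyw : y = 1 + nc w + nc (Pi.single i n) := by
      ext j
      by_cases hj : j = i
      · subst hj
        simp only [Pi.add_apply, Pi.one_apply, nc, w, if_true, Pi.single_eq_same]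
        push_cast; lia
      · have := hy j
        simp only [Pi.add_apply, Pi.one_apply, nc, w, hj, if_false, Pi.single_eq_of_ne hj]
        push_cast
        lia
    have hwN : ∀ j, (w j : ℝ) ≤ y i / N := by
      intro j
      rw [le_div_iff₀ hNR]
      by_cases hj : j = i
      · simp only [w, hj, if_true]
        push_cast; linarith
      · have h1 := hyN j hj
        have h2 : (w j : ℤ) ≤ y j := by
          have := hy j
          simp only [w, hj, if_false]
          lia
        have h3 : (w j : ℤ) * N ≤ y i := by nlinarith
        exact_mod_cast h3
    have hdown : f y (1 + nc (Pi.single i n)) ≤ y i / N * c := by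
      calc f y (1 + nc (Pi.single i n)) ≤ dn w := by
            have := hadd (nc (Pi.single i n)) (nc_nn _) _ (hmem w) _ hone
            rwa [← hyw] at this
        _ ≤ ∑ j, w j * dn (Pi.single j 1) := dn_le w
        _ ≤ ∑ j, y i / N * dn (Pi.single j 1) :=
            Finset.sum_le_sum fun j _ => mul_le_mul_of_nonneg_right (hwN j) (dn_nn _)
        _ = _ := by rw [hc, Finset.mul_sum]
    have hdown' : y i / N * c ≤ ε / 4 * y i := by
      rw [div_mul_eq_mul_div, div_le_iff₀ hNR]
      nlinarith
    refine ⟨n, by lia, ?_⟩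
    have h1 := htri _ hone _ hy _ (hmem (Pi.single i n))
    have h2 := htri _ hone _ hx' _ hy
    have : up (Pi.single i n) ≤ ε / 2 * y i := by
      simp only [up]; linarith
    rw [hnR] at this hy2
    nlinarith
  choose n hn hup using axis
  choose K hK using fun i => exists_le_mul_add_of_subadditive up0 up_add up_nn i (hn i) (hup i)
  refine ⟨f x 1 + ∑ i, K i, fun u hu => ?_⟩
  have huw : u = 1 + nc fun i => (u i - 1).toNat := by
    ext i
    have := hu i
    simp only [Pi.add_apply, Pi.one_apply, nc]
    lia
  have h1 : f 1 u ≤ ∑ i, (ε * u i + K i) := by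
    calc f 1 u = up fun i => (u i - 1).toNat := by simp only [up]; rw [← huw]
      _ ≤ ∑ i, up (Pi.single i (u i - 1).toNat) := le_sum_single_of_subadditive up0 up_add _
      _ ≤ _ := by
        refine Finset.sum_le_sum fun i _ => (hK i _).trans ?_
        have h2 : ((u i - 1).toNat : ℤ) ≤ u i := by
          have := hu i
          lia
        have h3 : ((u i - 1).toNat : ℝ) ≤ u i := by exact_mod_cast h2
        gcongr
  have h2 := htri x hx 1 hone u hu
  rw [Finset.sum_add_distrib, ← Finset.mul_sum] at h1
  linarith

end Subadditive

/-! ### Logarithmic asymptotics for centred walks in the orthant -/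

section Asymptotics

variable {ι : Type*} [Fintype ι] {ν : (ι → ℤ) → ℝ}

lemma Irred.eq_zero_of_pairing_eq_zero (hirr : Irred ν (orthant ι)) {b : ι → ℝ}
    (hb : ∀ z, 0 < ν z → pairing b z = 0) : b = 0 := by
  ext i
  have hone : (1 : ι → ℤ) ∈ orthant ι := fun i => by simp
  have htwo : 1 + Pi.single i 1 ∈ orthant ι := fun j => by
    have : (0 : ι → ℤ) ≤ Pi.single i 1 := Pi.single_nonneg.2 zero_le_one
    have := this j
    simp only [Pi.zero_apply] at this
    simp only [Pi.add_apply, Pi.one_apply]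
    lia
  obtain ⟨k, c, hc0, hck, -, hc⟩ := hirr _ hone _ htwo
  have hstep : ∀ j ≤ k, pairing b (c j) = pairing b (c 0) := by
    intro j hj
    induction j with
    | zero => rfl
    | succ j ih =>
      have := hb _ (hc j hj)
      rw [pairing_sub_right, ih (by lia)] at this
      linarith
  have h1 := hstep k le_rfl
  rw [hck, hc0, pairing_add_right, add_eq_left, pairing] at h1
  have h2 : (fun j => ((Pi.single i 1 : ι → ℤ) j : ℝ)) = Pi.single i 1 := by
    ext j
    by_cases hj : j = i
    · subst hj; simp
    · simp [hj]
  rw [h2, dotProduct_single, mul_one] at h1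
  exact h1

/-- Hitting probabilities of a centred walk killed outside the orthant decay subexponentially. -/
lemma tendsto_log_hitProb (hν : ∀ z, 0 ≤ ν z) (h : HasExpMoments ν) (h1 : HasSum ν 1)
    (h0 : ∀ i, HasSum (fun z => ν z * (z i : ℝ)) 0) (hirr : Irred ν (orthant ι))
    {x : ι → ℤ} (hx : x ∈ orthant ι) :
    Tendsto (fun u : ι → ℤ => (znorm u)⁻¹ * Real.log (hitProb ν (orthant ι) x u))
      (Filter.comap znorm atTop ⊓ 𝓟 (orthant ι)) (𝓝 0) := by
  have hp : ∑' z, ENNReal.ofReal (ν z) = 1 := by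
    rw [← ENNReal.ofReal_tsum_of_nonneg hν h1.summable, h1.tsum_eq, ENNReal.ofReal_one]
  set H : (ι → ℤ) → (ι → ℤ) → ℝ≥0∞ := hitE (fun z => ENNReal.ofReal (ν z)) (orthant ι) with hH
  have hle : ∀ x y, H x y ≤ 1 := hitE_le_one hp
  have hne : ∀ x y, H x y ≠ ⊤ := fun x y => ((hle x y).trans_lt ENNReal.one_lt_top).ne
  have hpos : ∀ x ∈ orthant ι, ∀ y ∈ orthant ι, 0 < (H x y).toReal := by
    intro x hx y hy
    obtain ⟨k, c, rfl, rfl, hcA, hc⟩ := hirr x hx y hy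
    exact ENNReal.toReal_pos
      (hitE_pos_of_path hp hcA fun j hj => ENNReal.ofReal_pos.2 (hc j hj)).ne' (hne _ _)
  let f : (ι → ℤ) → (ι → ℤ) → ℝ := fun x y => -Real.log (H x y).toReal
  have hf_nn : ∀ x y, 0 ≤ f x y := by
    intro x y
    have := ENNReal.toReal_mono ENNReal.one_ne_top (hle x y)
    exact neg_nonneg.2 (Real.log_nonpos ENNReal.toReal_nonneg (by simpa using this))
  have hbound : ∀ ε : ℝ, 0 < ε → ∃ K, ∀ u ∈ orthant ι, f x u ≤ ε * ∑ i, (u i : ℝ) + K := by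
    intro ε hε
    refine exists_le_mul_sum_add (f := f) (fun x _ y _ => hf_nn x y) ?_ ?_ ?_ ?_ hx hε
    · intro x hx
      simp [f, hH, hitE_self hx]
    · intro x hx z hz y hy
      have h2 := ENNReal.toReal_mono (hne x y) (hitE_mul_hitE_le hp x z hy)
      rw [ENNReal.toReal_mul] at h2
      have h3 := Real.log_le_log (mul_pos (hpos x hx z hz) (hpos z hz y hy)) h2
      rw [Real.log_mul (hpos x hx z hz).ne' (hpos z hz y hy).ne'] at h3
      simp only [f]
      linarith
    · intro w hw x hx y hy
      have hwA : ∀ z ∈ orthant ι, z + w ∈ orthant ι := fun z hz i =>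
        add_pos_of_pos_of_nonneg (hz i) (hw i)
      have h2 := ENNReal.toReal_mono (hne _ _) (hitE_le_hitE_add hwA x hy)
      exact neg_le_neg (Real.log_le_log (hpos x hx y hy) h2)
    · intro i N hN ε hε
      obtain ⟨x, hx, hR⟩ := h.exists_exp_le_hitE hν h1 h0
        (fun b hb => hirr.eq_zero_of_pairing_eq_zero hb) hp i hN hε
      refine ⟨x, hx, fun R => ?_⟩
      obtain ⟨y, hy, hyN, hyR, hexp⟩ := hR R
      refine ⟨y, hy, hyN, hyR, ?_⟩
      have := Real.log_le_log (Real.exp_pos _) hexp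
      rw [Real.log_exp] at this
      simp only [f]
      linarith
  have hznorm : ∀ u ∈ orthant ι, znorm u = ∑ i, (u i : ℝ) := fun u hu =>
    Finset.sum_congr rfl fun i _ => abs_of_pos (by exact_mod_cast hu i)
  rw [Metric.tendsto_nhds]
  intro ε hε
  obtain ⟨K, hK⟩ := hbound (ε / 2) (half_pos hε)
  rw [eventually_inf_principal]
  filter_upwards [tendsto_comap.eventually (eventually_gt_atTop (max 0 (2 * K / ε)))]
    with u hu huA
  have hu0 : 0 < znorm u := (le_max_left _ _).trans_lt hu
  have huK : 2 * K < znorm u * ε := by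
    rw [← div_lt_iff₀ hε]; exact (le_max_right _ _).trans_lt hu
  have h2 := hK u huA
  rw [← hznorm u huA] at h2
  have h3 : |Real.log (hitProb ν (orthant ι) x u)| = f x u := by
    rw [← abs_of_nonneg (hf_nn x u), abs_neg, hitProb_eq_toReal hν hp]
  rw [Real.dist_eq, sub_zero, abs_mul, abs_inv, abs_of_pos hu0, h3, inv_mul_lt_iff₀ hu0]
  linarith

end Asymptotics

/-! ### The projected walk -/

section Projection

variable {d : ℕ} {μ : (Fin d → ℤ) → ℝ}

lemma A2.hasExpMoments (hnn : ∀ z, 0 ≤ μ z) (hsum : HasSum μ 1) (hA2 : A2 μ) :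
    HasExpMoments μ := by
  obtain ⟨U, hU, hDU, hfin⟩ := hA2
  have h0 : (0 : Fin d → ℝ) ∈ U := by
    refine hDU ?_
    simp only [Dset, phiE, dotZ, Set.mem_ofPred_eq, Pi.zero_apply, zero_mul,
      Finset.sum_const_zero, Real.exp_zero, mul_one]
    rw [← ENNReal.ofReal_tsum_of_nonneg hnn hsum.summable, hsum.tsum_eq, ENNReal.ofReal_one]
  obtain ⟨r, hr, hball⟩ := Metric.isOpen_iff.1 hU 0 h0
  refine ⟨r / 2, half_pos hr, fun a ha => ?_⟩
  have haU : a ∈ U := by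
    refine hball ?_
    rw [mem_ball_zero_iff]
    refine lt_of_le_of_lt ((pi_norm_le_iff_of_nonneg (half_pos hr).le).2 fun i => ?_)
      (half_lt_self hr)
    simpa using ha i
  refine (ENNReal.summable_toReal (hfin a haU)).congr fun z => ?_
  rw [ENNReal.toReal_ofReal (mul_nonneg (hnn z) (Real.exp_pos _).le)]
  rfl

lemma HasSum.muL_mul {Λ : Set (Fin d)} {g : (Λ → ℤ) → ℝ} {s : ℝ}
    (hg : HasSum (fun x => μ x * g (projL Λ x)) s) : HasSum (fun v => muL μ Λ v * g v) s := by
  refine (hg.tsum_fiberwise (projL Λ)).congr_fun fun v => ?_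
  have h1 : muL μ Λ v = ∑' x : projL Λ ⁻¹' {v}, μ x := by
    rw [tsum_subtype, muL]
    congr 1
    ext x
    by_cases hx : projL Λ x = v <;> simp [hx, Set.indicator]
  rw [h1, ← tsum_mul_right]
  refine tsum_congr fun x => ?_
  rw [show projL Λ x = v from x.2]

lemma muL_nonneg (hnn : ∀ z, 0 ≤ μ z) (Λ : Set (Fin d)) (v : Λ → ℤ) : 0 ≤ muL μ Λ v :=
  tsum_nonneg fun x => by split_ifs <;> simp [hnn]

lemma le_muL (hnn : ∀ z, 0 ≤ μ z) (hμ : Summable μ) (Λ : Set (Fin d)) (x : Fin d → ℤ) :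
    μ x ≤ muL μ Λ (projL Λ x) := by
  have hs : Summable fun y => if projL Λ y = projL Λ x then μ y else 0 :=
    hμ.of_nonneg_of_le (fun y => by split_ifs <;> simp [hnn])
      fun y => by split_ifs <;> simp [hnn]
  have := hs.le_tsum x fun y _ => by split_ifs <;> simp [hnn]
  rw [muL]
  simpa using this

lemma HasExpMoments.muL (h : HasExpMoments μ) (Λ : Set (Fin d)) :
    HasExpMoments (muL μ Λ) := by
  obtain ⟨δ, hδ, hs⟩ := h
  refine ⟨δ, hδ, fun a ha => ?_⟩
  let b : Fin d → ℝ := fun i => if hi : i ∈ Λ then a ⟨i, hi⟩ else 0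
  have hb : ∀ i, |b i| ≤ δ := by
    intro i
    simp only [b]
    split_ifs with hi
    · exact ha _
    · simpa using hδ.le
  have hpair : ∀ x, pairing b x = pairing a (projL Λ x) := by
    intro x
    refine (Fintype.sum_of_injective (Subtype.val : Λ → Fin d) Subtype.val_injective
      (fun i => a i * (projL Λ x i : ℝ)) (fun i => b i * (x i : ℝ)) ?_ ?_).symm
    · intro i hi
      have : i ∉ Λ := by simpa using hi
      simp [b, this]
    · intro i
      simp [b, projL]
  have h1 := hs b hb
  simp only [hpair] at h1
  exact (HasSum.muL_mul (g := fun v => Real.exp (pairing a v)) h1.hasSum).summable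

lemma HasExpMoments.summable_mul_coord (hnn : ∀ z, 0 ≤ μ z) (hμ : Summable μ)
    (h : HasExpMoments μ) (i : Fin d) : Summable fun z => μ z * (z i : ℝ) := by
  have h2 := h.summable_sq hnn (Pi.single i 1)
  simp only [pairing, single_dotProduct, one_mul] at h2
  refine Summable.of_norm_bounded (hμ.add h2) fun z => ?_
  rw [norm_mul, Real.norm_of_nonneg (hnn z), Real.norm_eq_abs]
  have : |(z i : ℝ)| ≤ 1 + (z i : ℝ) ^ 2 := by
    rw [abs_le]
    constructor <;> nlinarith [sq_nonneg ((z i : ℝ) + 1), sq_nonneg ((z i : ℝ) - 1)]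
  calc _ ≤ μ z * (1 + (z i : ℝ) ^ 2) := mul_le_mul_of_nonneg_left this (hnn z)
    _ = _ := by ring

lemma A1.irred_muL (hnn : ∀ z, 0 ≤ μ z) (hμ : Summable μ) (hA1 : A1 μ) (Λ : Set (Fin d)) :
    Irred (muL μ Λ) (orthant Λ) := by
  intro u hu u' hu'
  let ext0 : (Λ → ℤ) → Fin d → ℤ := fun u i => if hi : i ∈ Λ then u ⟨i, hi⟩ else 0
  have hproj : ∀ u, projL Λ (ext0 u) = u := fun u => by
    ext i
    simp [projL, ext0]
  have hext : ∀ u ∈ orthant Λ, ext0 u ∈ posDom Λ := fun u hu i hi => by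
    simpa [ext0, hi] using hu ⟨i, hi⟩
  obtain ⟨k, c, hc0, hck, hcA, hc⟩ := hA1 Λ _ (hext u hu) _ (hext u' hu')
  refine ⟨k, fun j => projL Λ (c j), ?_, ?_, fun j hj i => hcA j hj i i.2, fun j hj => ?_⟩
  · simp only [hc0, hproj]
  · simp only [hck, hproj]
  · exact (hc j hj).trans_le (le_muL hnn hμ Λ (c (j + 1) - c j))

end Projection

theorem statement10 {d : ℕ} (μ : (Fin d → ℤ) → ℝ)
    (hnn : ∀ z, 0 ≤ μ z) (hsum : HasSum μ 1)
    (hA1 : A1 μ) (hA2 : A2 μ) (hA3 : A3 μ)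
    (uhat : ↥(LambdaM μ) → ℤ) (huhat : uhat ∈ posL (LambdaM μ)) :
    Tendsto
      (fun u : ↥(LambdaM μ) → ℤ =>
        (znorm u)⁻¹ * Real.log (hitProb (muL μ (LambdaM μ)) (posL (LambdaM μ)) uhat u))
      (Filter.comap znorm atTop ⊓ 𝓟 (posL (LambdaM μ))) (𝓝 0) := by
  refine tendsto_log_hitProb (muL_nonneg hnn _) ((hA2.hasExpMoments hnn hsum).muL _) ?_ ?_
    (hA1.irred_muL hnn hsum.summable _) huhat
  · have h1 : HasSum (fun x => μ x * 1) 1 := by simpa using hsum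
    simpa using HasSum.muL_mul (Λ := LambdaM μ) (g := fun _ => 1) h1
  · intro i
    have h1 := ((hA2.hasExpMoments hnn hsum).summable_mul_coord hnn hsum.summable i).hasSum
    have h2 : ∑' z, μ z * (z i : ℝ) = 0 := i.2
    rw [h2] at h1
    exact HasSum.muL_mul (g := fun v => (v i : ℝ)) h1
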